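/- arXiv:2111.09958 — 3 statements merged into one kernel-verified Lean document; each statement's English description precedes it below -/
import Mathlib

section
/- Weight independence of nodal velocity projection (velocity part of the paper's Theorem 2): Let m be a positive integer, let E be a type, let X : Fin m → E be the structural mesh nodes, and let ψ : Fin m → E → ℝ be a nodal basis, i.e. ψ i (X j) = 1 if i = j and ψ i (X j) = 0 if i ≠ j. Let U_IB : E → ℝ be any function (the interpolated Eulerian velocity), and let w : Fin m → ℝ be any weights with w q ≠ 0 for all q. Define the nodal-quadrature mass matrix D i j = ∑_{q} ψ i (X q) * ψ j (X q) * (w q) and right-hand side L i = ∑_{q} U_IB (X q) * ψ i (X q) * (w q). Then the vector U : Fin m → ℝ defined by U i = U_IB (X i) satisfies ∑_j (D i j) * (U j) = L i for every i, and it is the unique such vector; in particular the projected velocity coefficients equal the pointwise nodal interpolation values of U_IB and are independent of the choice of nonzero weights w. -/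
/-- Weight independence of nodal velocity projection (velocity part of Theorem 2):
the vector of nodal values `U i = U_IB (X i)` solves the nodal-quadrature projection
system `D U = L`, and it is the unique solution; in particular the projected velocity
coefficients are the pointwise nodal interpolation values of `U_IB`, independent of
the choice of nonzero weights `w`. -/
theorem nodal_velocity_projection_weight_independent
    (m : ℕ) (hm : 0 < m) (E : Type*)
    (X : Fin m → E) (ψ : Fin m → E → ℝ)
    (hψ : ∀ i j, ψ i (X j) = if i = j then 1 else 0)
    (U_IB : E → ℝ)
    (w : Fin m → ℝ) (hw : ∀ q, w q ≠ 0)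
    (D : Fin m → Fin m → ℝ)
    (hD : ∀ i j, D i j = ∑ q, ψ i (X q) * ψ j (X q) * w q)
    (L : Fin m → ℝ)
    (hL : ∀ i, L i = ∑ q, U_IB (X q) * ψ i (X q) * w q) :
    (∀ i, ∑ j, D i j * U_IB (X j) = L i) ∧
      (∀ V : Fin m → ℝ, (∀ i, ∑ j, D i j * V j = L i) →
        V = fun i => U_IB (X i)) := by
  have hD' : ∀ i j, D i j = if i = j then w i else 0 := fun i j => by
    by_cases h : i = j
    · subst h
      simp [hD, hψ]
    · simp [hD, hψ, h]
  have hDV : ∀ (V : Fin m → ℝ) (i : Fin m), ∑ j, D i j * V j = w i * V i := fun V i => by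
    simp [hD']
  have hL' : ∀ i, L i = w i * U_IB (X i) := fun i => by
    simp [hL, hψ, mul_comm]
  refine ⟨fun i => ?_, fun V hV => funext fun i => mul_left_cancel₀ (hw i) ?_⟩
  · rw [hDV (fun j => U_IB (X j)), hL']
  · rw [← hDV V, hV, hL']
end

section
/- The paper's Theorem 3, zeroth moment (total Eulerian force is independent of the shared quadrature rule): For each component n ∈ {1,2,3}, let Gₙ be a finite index set with staggered grid points xₙ : Gₙ → ℝ³, let Δx > 0, let Q be a finite index set with quadrature points X : Q → E and weights w : Q → ℝ, and let ψ : Fin m → E → ℝ be scalar basis functions with ∑_i ψ i (X q) = 1 for all q ∈ Q (partition of unity at quadrature points). Let χ_h : E → ℝ³ be the deformed configuration map and suppose the kernel δ_h : ℝ³ → ℝ satisfies the discrete zeroth moment condition ∑_{g ∈ Gₙ} Δx^3 * δ_h(xₙ g − χ_h(X q)) = 1 for every n and every q ∈ Q. For each n, let Fⁿ : Fin m → ℝ be force coefficient vectors, set Fⁿ_h(Y) = ∑_j (Fⁿ j) * ψ j(Y), define the quadrature mass matrix M i j = ∑_q ψ i(X q) * ψ j(X q) * (w q), the load vectors Lⁿ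 = M Fⁿ, and the spread grid forces fⁿ g = ∑_{q ∈ Q} Fⁿ_h(X q) * δ_h(xₙ g − χ_h(X q)) * (w q). Then ∑_{n=1}^{3} ∑_{g ∈ Gₙ} Δx^3 * (fⁿ g) = ∑_{n=1}^{3} ∑_{i} (Lⁿ i); that is, the total spread Eulerian force equals 1ᵀ L and hence is the same for every quadrature rule used simultaneously for the mass matrix and for force spreading. -/
/-- Theorem 3, zeroth moment: the total spread Eulerian force equals `1ᵀ L`, where
`L = M F` with the quadrature mass matrix `M`, hence is the same for every quadrature
rule used simultaneously for the mass matrix and for force spreading. Here `n : Fin 3`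
indexes the components, `G n` the faces of the staggered grid for component `n`, and
the kernel satisfies the discrete zeroth moment condition at each deformed quadrature
point. -/
theorem total_eulerian_force_quadrature_independent
    (m : ℕ) (hm : 0 < m) (E : Type*) (Q : Type*) [Fintype Q]
    (G : Fin 3 → Type*) [∀ n, Fintype (G n)]
    (x : ∀ n, G n → Fin 3 → ℝ)
    (Δx : ℝ) (hΔx : 0 < Δx)
    (X : Q → E) (w : Q → ℝ)
    (ψ : Fin m → E → ℝ)
    (hpu : ∀ q : Q, ∑ i, ψ i (X q) = 1)
    (χh : E → Fin 3 → ℝ)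
    (δh : (Fin 3 → ℝ) → ℝ)
    (hδ : ∀ n, ∀ q : Q, ∑ g, Δx ^ 3 * δh (x n g - χh (X q)) = 1)
    (F : Fin 3 → Fin m → ℝ)
    (Fh : Fin 3 → E → ℝ) (hFh : ∀ n Y, Fh n Y = ∑ j, F n j * ψ j Y)
    (M : Fin m → Fin m → ℝ)
    (hM : ∀ i j, M i j = ∑ q, ψ i (X q) * ψ j (X q) * w q)
    (L : Fin 3 → Fin m → ℝ)
    (hL : ∀ n i, L n i = ∑ j, M i j * F n j)
    (f : ∀ n, G n → ℝ)
    (hf : ∀ n g, f n g = ∑ q, Fh n (X q) * δh (x n g - χh (X q)) * w q) :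
    ∑ n : Fin 3, ∑ g, Δx ^ 3 * f n g = ∑ n : Fin 3, ∑ i, L n i := by
  refine Finset.sum_congr rfl fun n _ => ?_
  have eulerian : ∑ g, Δx ^ 3 * f n g = ∑ q, Fh n (X q) * w q := by
    simp_rw [hf, Finset.mul_sum]
    rw [Finset.sum_comm]
    refine Finset.sum_congr rfl fun q _ => ?_
    calc ∑ g, Δx ^ 3 * (Fh n (X q) * δh (x n g - χh (X q)) * w q)
        = Fh n (X q) * w q * ∑ g, Δx ^ 3 * δh (x n g - χh (X q)) := by
          rw [Finset.mul_sum]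
          exact Finset.sum_congr rfl fun g _ => by ring
      _ = Fh n (X q) * w q := by rw [hδ, mul_one]
  have load (i : Fin m) : L n i = ∑ q, ψ i (X q) * (Fh n (X q) * w q) := by
    simp_rw [hL, hM, hFh, Finset.sum_mul, Finset.mul_sum]
    rw [Finset.sum_comm]
    exact Finset.sum_congr rfl fun q _ => Finset.sum_congr rfl fun j _ => by ring
  simp_rw [eulerian, load]
  rw [Finset.sum_comm]
  simp_rw [← Finset.sum_mul, hpu, one_mul]
end

section
/- The paper's Theorem 3, first moment (total Eulerian first force moment is independent of the shared quadrature rule): For each component n ∈ {1,2,3}, let Gₙ be a finite index set with staggered grid points xₙ : Gₙ → ℝ³, let Δx > 0, let Q be a finite index set with quadrature points X : Q → E and weights w : Q → ℝ, and let ψ : Fin m → E → ℝ be scalar basis functions. Let χⁿ : Fin m → ℝ be coefficient vectors of the deformation components, with χ_h : E → ℝ³ given componentwise by χ_h(Y)ₙ = ∑_i (χⁿ i) * ψ i(Y). Suppose the kernel δ_h : ℝ³ → ℝ satisfies the discrete first moment conditions ∑_{g ∈ Gₙ} Δx^3 * (xₙ g)ₙ * δ_h(xₙ g − χ_h(X q))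 = (χ_h(X q))ₙ for every n and every q ∈ Q, where (·)ₙ is the n-th coordinate. For each n, let Fⁿ : Fin m → ℝ be force coefficient vectors, set Fⁿ_h(Y) = ∑_j (Fⁿ j) * ψ j(Y), define M i j = ∑_q ψ i(X q) * ψ j(X q) * (w q), Lⁿ = M Fⁿ, and fⁿ g = ∑_{q ∈ Q} Fⁿ_h(X q) * δ_h(xₙ g − χ_h(X q)) * (w q). Then ∑_{n=1}^{3} ∑_{g ∈ Gₙ} Δx^3 * (xₙ g)ₙ * (fⁿ g) = ∑_{n=1}^{3} ∑_{i} (χⁿ i) * (Lⁿ i); that is, the total first moment of the spread Eulerian force equals χᵀ L and hence is the same for every quadrature rule used simultaneously for the mass matrix and for force spreading. -/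
/-- Theorem 3, first moment: the total first moment of the spread Eulerian force equals
`χᵀ L`, where `L = M F` with the quadrature mass matrix `M`, hence is the same for
every quadrature rule used simultaneously for the mass matrix and for force spreading.
Here `n : Fin 3` indexes the components, `G n` the faces of the staggered grid for
component `n`, `χc n` is the coefficient vector of the `n`-th deformation component,
and the kernel satisfies the discrete first moment condition in coordinate `n` at each
deformed quadrature point. -/
theorem first_moment_eulerian_force_quadrature_independent
    (m : ℕ) (hm : 0 < m) (E : Type*) (Q : Type*) [Fintype Q]
    (G : Fin 3 → Type*) [∀ n, Fintype (G n)]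
    (x : ∀ n, G n → Fin 3 → ℝ)
    (Δx : ℝ) (hΔx : 0 < Δx)
    (X : Q → E) (w : Q → ℝ)
    (ψ : Fin m → E → ℝ)
    (χc : Fin 3 → Fin m → ℝ)
    (χh : E → Fin 3 → ℝ) (hχh : ∀ Y n, χh Y n = ∑ i, χc n i * ψ i Y)
    (δh : (Fin 3 → ℝ) → ℝ)
    (hδ : ∀ n, ∀ q : Q,
      ∑ g, Δx ^ 3 * (x n g n) * δh (x n g - χh (X q)) = χh (X q) n)
    (F : Fin 3 → Fin m → ℝ)
    (Fh : Fin 3 → E → ℝ) (hFh : ∀ n Y, Fh n Y = ∑ j, F n j * ψ j Y)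
    (M : Fin m → Fin m → ℝ)
    (hM : ∀ i j, M i j = ∑ q, ψ i (X q) * ψ j (X q) * w q)
    (L : Fin 3 → Fin m → ℝ)
    (hL : ∀ n i, L n i = ∑ j, M i j * F n j)
    (f : ∀ n, G n → ℝ)
    (hf : ∀ n g, f n g = ∑ q, Fh n (X q) * δh (x n g - χh (X q)) * w q) :
    ∑ n : Fin 3, ∑ g, Δx ^ 3 * (x n g n) * f n g
      = ∑ n : Fin 3, ∑ i, χc n i * L n i := by
  refine Finset.sum_congr rfl fun n _ => ?_
  trans ∑ q, Fh n (X q) * χh (X q) n * w q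
  · simp only [hf, Finset.mul_sum]
    rw [Finset.sum_comm]
    refine Finset.sum_congr rfl fun q _ => ?_
    rw [← hδ n q, Finset.mul_sum, Finset.sum_mul]
    exact Finset.sum_congr rfl fun g _ => by ring
  · simp only [hL, hM, hχh, hFh, Finset.sum_mul, Finset.mul_sum]
    rw [Finset.sum_comm]
    refine Finset.sum_congr rfl fun i _ => ?_
    rw [Finset.sum_comm]
    refine Finset.sum_congr rfl fun j _ => Finset.sum_congr rfl fun q _ => ?_
    ring
end
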